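/- If (X_β, S) is Li–Yorke chaotic modulo an ideal I for some index β, then the product transformation semigroup (∏_α X_α, S) with diagonal action is Li–Yorke chaotic modulo I. -/

import Mathlib

/-- An ideal on (the carrier of) a semigroup `S`. -/
def IsIdealOn {S : Type*} (I : Set (Set S)) : Prop :=
  I.Nonempty ∧ (∀ A ∈ I, ∀ B : Set S, B ⊆ A → B ∈ I) ∧ ∀ A ∈ I, ∀ B ∈ I, A ∪ B ∈ I

/-- Asymptoticity modulo an ideal in a transformation semigroup. -/
def AsymMod (S X : Type*) [UniformSpace X] [SMul S X] (I : Set (Set S)) (x y : X) : Prop :=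
  ∀ α ∈ uniformity X, {s : S | (s • x, s • y) ∉ α} ∈ I

/-- Proximality in a transformation semigroup (via a net encoded as a nontrivial filter). -/
def ProxPair (S X : Type*) [TopologicalSpace X] [SMul S X] (x y : X) : Prop :=
  ∃ z : X, ∃ l : Filter S, l.NeBot ∧
    Filter.Tendsto (fun s => s • x) l (nhds z) ∧ Filter.Tendsto (fun s => s • y) l (nhds z)

/-- `(X, S)` is Li–Yorke chaotic modulo `I`: it has an uncountable set every two distinct
points of which are proximal and not asymptotic modulo `I`. -/
def LiYorkeMod (S X : Type*) [UniformSpace X] [SMul S X] (I : Set (Set S)) : Prop :=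
  ∃ D : Set X, ¬ D.Countable ∧
    ∀ x ∈ D, ∀ y ∈ D, x ≠ y → ProxPair S X x y ∧ ¬ AsymMod S X I x y

/-- On a product of compact spaces, two points that agree off `β` and whose `β`-coordinates
form a proximal pair are proximal. -/
theorem ProxPair.pi_of_eq_off {ι S : Type*} {X : ι → Type*} [∀ i, TopologicalSpace (X i)]
    [∀ i, CompactSpace (X i)] [∀ i, SMul S (X i)] {β : ι} {x y : ∀ i, X i}
    (hne : ∀ i, i ≠ β → x i = y i) (h : ProxPair S (X β) (x β) (y β)) :
    ProxPair S (∀ i, X i) x y := by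
  obtain ⟨z, l, hl, hx, hy⟩ := h
  have hle := Ultrafilter.of_le l
  have key : ∀ i, ∃ w : X i,
      Filter.Tendsto (fun s : S => s • x i) (Ultrafilter.of l) (nhds w) ∧
      Filter.Tendsto (fun s : S => s • y i) (Ultrafilter.of l) (nhds w) := by
    intro i
    by_cases hi : i = β
    · subst hi
      exact ⟨z, hx.mono_left hle, hy.mono_left hle⟩
    · rw [← hne i hi]
      have hlim : Filter.Tendsto (fun s : S => s • x i) (Ultrafilter.of l)
          (nhds ((Ultrafilter.of l).map fun s : S => s • x i).lim) :=
        Ultrafilter.le_nhds_lim _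
      exact ⟨_, hlim, hlim⟩
  choose w hwx hwy using key
  exact ⟨w, Ultrafilter.of l, inferInstance, tendsto_pi_nhds.2 hwx, tendsto_pi_nhds.2 hwy⟩

/-- Points of a product that are asymptotic modulo `I` have coordinates asymptotic modulo `I`. -/
theorem AsymMod.apply {ι S : Type*} {X : ι → Type*} [∀ i, UniformSpace (X i)]
    [∀ i, SMul S (X i)] {I : Set (Set S)} {x y : ∀ i, X i}
    (h : AsymMod S (∀ i, X i) I x y) (i : ι) : AsymMod S (X i) I (x i) (y i) :=
  fun _ hα => h _ (Pi.uniformContinuous_proj X i hα)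

/-- If some factor `(X β, S)` is Li–Yorke chaotic modulo `I`, then the product transformation
semigroup with the diagonal action is Li–Yorke chaotic modulo `I`. -/
theorem stmt4 {ι S : Type*} [Monoid S] (X : ι → Type*)
    [∀ i, UniformSpace (X i)] [∀ i, CompactSpace (X i)] [∀ i, T2Space (X i)]
    [∀ i, Nonempty (X i)]
    [∀ i, MulAction S (X i)] (hcont : ∀ i (s : S), Continuous fun x : X i => s • x)
    (I : Set (Set S)) (hI : IsIdealOn I)
    (β : ι) (h : LiYorkeMod S (X β) I) : LiYorkeMod S (∀ i, X i) I := by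
  classical
  obtain ⟨D, hD, hpair⟩ := h
  let p : ∀ i, X i := fun i => Classical.arbitrary (X i)
  refine ⟨Function.update p β '' D, fun hc => hD ?_, ?_⟩
  · exact Set.countable_of_injective_of_countable_image
      (Function.update_injective p β).injOn hc
  · rintro _ ⟨a, ha, rfl⟩ _ ⟨b, hb, rfl⟩ hab
    obtain ⟨hprox, hasym⟩ := hpair a ha b hb fun e => hab (e ▸ rfl)
    refine ⟨ProxPair.pi_of_eq_off (β := β) (fun i hi => ?_) ?_, fun h => hasym ?_⟩
    · simp [hi]
    · simpa using hprox
    · simpa using h.apply β
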